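/- arXiv:1901.08562 — 6 statements merged into one kernel-verified Lean document; each statement's English description precedes it below -/
import Mathlib

section
/- Let σ > 0 and let X be a Gaussian random variable with mean 0 and variance σ². Then for every t ≥ 0, Pr[|X| ≥ t] ≥ √(e/(2π)) · exp(−t²/σ²). -/
open MeasureTheory ProbabilityTheory Real

/-- The density of `N(0, σ²)` dominates that of a rescaled Rayleigh distribution. -/
lemma mul_exp_neg_sq_le_gaussianPDFReal {σ : ℝ} (hσ : 0 < σ) (x : ℝ) :
    √(exp 1 / (2 * π)) * (x / σ ^ 2 * exp (-x ^ 2 / σ ^ 2)) ≤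
      gaussianPDFReal 0 (σ ^ 2).toNNReal x := by
  have hsqrt : √(2 * π * σ ^ 2) = √(2 * π) * σ := by
    rw [Real.sqrt_mul (by positivity), Real.sqrt_sq hσ.le]
  have hle : x / σ ≤ exp (((x / σ) ^ 2 - 1) / 2) := by
    nlinarith [Real.add_one_le_exp (((x / σ) ^ 2 - 1) / 2), sq_nonneg (x / σ - 1)]
  have hexp : exp (1 / 2) * exp (((x / σ) ^ 2 - 1) / 2) * exp (-x ^ 2 / σ ^ 2) =
      exp (-x ^ 2 / (2 * σ ^ 2)) := by
    rw [← Real.exp_add, ← Real.exp_add]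
    congr 1
    field_simp
    ring
  rw [gaussianPDFReal, Real.coe_toNNReal _ (sq_nonneg σ), sub_zero, hsqrt,
    Real.sqrt_div (Real.exp_pos 1).le, ← Real.exp_half, ← hexp]
  calc exp (1 / 2) / √(2 * π) * (x / σ ^ 2 * exp (-x ^ 2 / σ ^ 2))
      = (√(2 * π) * σ)⁻¹ * (exp (1 / 2) * (x / σ) * exp (-x ^ 2 / σ ^ 2)) := by
        field_simp
    _ ≤ _ := by gcongr

lemma hasDerivAt_neg_half_exp_neg_sq (C σ x : ℝ) :
    HasDerivAt (fun y ↦ -(C / 2) * exp (-y ^ 2 / σ ^ 2))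
      (C * (x / σ ^ 2 * exp (-x ^ 2 / σ ^ 2))) x := by
  have h := ((((hasDerivAt_pow 2 x).neg).div_const (σ ^ 2)).exp).const_mul (-(C / 2))
  refine h.congr_deriv ?_
  simp only [Pi.neg_apply]
  push_cast
  ring

lemma tendsto_exp_neg_sq_div {σ : ℝ} (hσ : 0 < σ) :
    Filter.Tendsto (fun y : ℝ ↦ exp (-y ^ 2 / σ ^ 2)) Filter.atTop (nhds 0) := by
  refine Real.tendsto_exp_atBot.comp ?_
  refine Filter.Tendsto.atBot_div_const (by positivity) ?_
  exact Filter.tendsto_neg_atTop_atBot.comp (Filter.tendsto_pow_atTop two_ne_zero)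

lemma gaussianReal_Ioi_lower_bound {σ : ℝ} (hσ : 0 < σ) {t : ℝ} (ht : 0 ≤ t) :
    ENNReal.ofReal (√(exp 1 / (2 * π)) / 2 * exp (-t ^ 2 / σ ^ 2)) ≤
      gaussianReal 0 (σ ^ 2).toNNReal (Set.Ioi t) := by
  have hv : (σ ^ 2).toNNReal ≠ 0 := by
    simpa using hσ.ne'
  have hderiv := hasDerivAt_neg_half_exp_neg_sq √(exp 1 / (2 * π)) σ
  have hnonneg : ∀ x ∈ Set.Ioi t,
      0 ≤ √(exp 1 / (2 * π)) * (x / σ ^ 2 * exp (-x ^ 2 / σ ^ 2)) := fun x hx ↦ by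
    have : 0 ≤ x := ht.trans (le_of_lt hx)
    positivity
  have hlim := (tendsto_exp_neg_sq_div hσ).const_mul (-(√(exp 1 / (2 * π)) / 2))
  have hint := integrableOn_Ioi_deriv_of_nonneg' (fun x _ ↦ hderiv x) hnonneg hlim
  have heq := integral_Ioi_of_hasDerivAt_of_nonneg' (fun x _ ↦ hderiv x) hnonneg hlim
  rw [gaussianReal_apply_eq_integral _ hv]
  refine ENNReal.ofReal_le_ofReal ?_
  calc √(exp 1 / (2 * π)) / 2 * exp (-t ^ 2 / σ ^ 2)
      = ∫ x in Set.Ioi t, √(exp 1 / (2 * π)) * (x / σ ^ 2 * exp (-x ^ 2 / σ ^ 2)) := by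
        rw [heq]; ring
    _ ≤ _ := integral_mono hint (integrable_gaussianPDFReal _ _).integrableOn
        (mul_exp_neg_sq_le_gaussianPDFReal hσ)

lemma gaussianReal_zero_Iio_neg (v : NNReal) (t : ℝ) :
    gaussianReal 0 v (Set.Iio (-t)) = gaussianReal 0 v (Set.Ioi t) := by
  have h := gaussianReal_map_neg (μ := 0) (v := v)
  rw [neg_zero] at h
  conv_lhs => rw [← h, Measure.map_apply measurable_neg measurableSet_Iio]
  simp

/-- (Gaussian tail lower bound.) For `X ∼ N(0, σ²)` with `σ > 0` and any `t ≥ 0`,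
`Pr[|X| ≥ t] ≥ √(e/(2π)) · exp(−t²/σ²)`. -/
theorem gaussian_abs_tail_lower_bound (σ : ℝ) (hσ : 0 < σ) (t : ℝ) (ht : 0 ≤ t) :
    ENNReal.ofReal (Real.sqrt (Real.exp 1 / (2 * π)) * Real.exp (-t ^ 2 / σ ^ 2)) ≤
      gaussianReal 0 (σ ^ 2).toNNReal {x | t ≤ |x|} := by
  have hsub : Set.Ioi t ∪ Set.Iio (-t) ⊆ {x | t ≤ |x|} := by
    rintro x (hx | hx)
    · exact le_abs.2 (Or.inl (Set.mem_Ioi.1 hx).le)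
    · exact le_abs.2 (Or.inr (le_neg_of_le_neg (Set.mem_Iio.1 hx).le))
  have hdisj : Disjoint (Set.Ioi t) (Set.Iio (-t)) :=
    Set.disjoint_left.2 fun x hx hx' ↦ by
      rw [Set.mem_Ioi] at hx
      rw [Set.mem_Iio] at hx'
      linarith
  refine le_trans ?_ (measure_mono hsub)
  rw [measure_union hdisj measurableSet_Iio, gaussianReal_zero_Iio_neg]
  refine le_trans (le_of_eq ?_)
    (add_le_add (gaussianReal_Ioi_lower_bound hσ ht) (gaussianReal_Ioi_lower_bound hσ ht))
  rw [← ENNReal.ofReal_add (by positivity) (by positivity)]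
  congr 1
  ring
end

section
/- Let σ > 0, let n = 2k be an even positive integer, let x^{(1)}, …, x^{(n)} be i.i.d. Gaussian random variables with mean 0 and variance σ², and let x̄ = n^{-1} Σ_{i=1}^n (x^{(i)})². Then for every ε ≥ 0, Pr[x̄ ≥ σ² + ε] ≥ (1/(e²√(2n))) · exp(−n ε / (2σ²)). -/
open MeasureTheory ProbabilityTheory Real

open scoped NNReal ENNReal Nat

/-- A product of measures with densities has the product density. -/
theorem pi_withDensity_ofReal {ι : Type*} [Fintype ι] {E : ι → Type*}
    [∀ i, MeasurableSpace (E i)] (μ : ∀ i, Measure (E i)) [∀ i, SigmaFinite (μ i)]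
    (f : ∀ i, E i → ℝ) (hf : ∀ i, Integrable (f i) (μ i)) (hf₀ : ∀ i x, 0 ≤ f i x) :
    (Measure.pi fun i => (μ i).withDensity fun x => ENNReal.ofReal (f i x)) =
      (Measure.pi μ).withDensity fun x => ENNReal.ofReal (∏ i, f i (x i)) := by
  have hsf : ∀ i, SigmaFinite ((μ i).withDensity fun x => ENNReal.ofReal (f i x)) := fun i =>
    SigmaFinite.withDensity_ofReal (f i)
  refine (Measure.pi_eq fun s hs => ?_)
  have hprod : ∀ x, (Set.univ.pi s).indicator (fun x => ∏ i, f i (x i)) x =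
      ∏ i, (s i).indicator (f i) (x i) := by
    intro x
    by_cases hx : x ∈ Set.univ.pi s
    · rw [Set.indicator_of_mem hx]
      exact Finset.prod_congr rfl fun i _ => (Set.indicator_of_mem (hx i trivial) _).symm
    · rw [Set.indicator_of_notMem hx]
      simp only [Set.mem_pi, Set.mem_univ, true_imp_iff, not_forall] at hx
      obtain ⟨i, hi⟩ := hx
      exact (Finset.prod_eq_zero (Finset.mem_univ i) (Set.indicator_of_notMem hi _)).symm
  rw [withDensity_apply _ (MeasurableSet.univ_pi hs), ← ofReal_integral_eq_lintegral_ofReal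
    (Integrable.fintype_prod_dep hf).integrableOn
    (ae_of_all _ fun x => Finset.prod_nonneg fun i _ => hf₀ i _),
    ← integral_indicator (MeasurableSet.univ_pi hs)]
  simp_rw [hprod]
  rw [integral_fintype_prod_eq_prod, ENNReal.ofReal_prod_of_nonneg fun i _ =>
    integral_nonneg fun x => Set.indicator_nonneg (fun x _ => hf₀ i x) x]
  refine Finset.prod_congr rfl fun i _ => ?_
  rw [withDensity_apply _ (hs i), ← ofReal_integral_eq_lintegral_ofReal (hf i).integrableOn
    (ae_of_all _ (hf₀ i)), integral_indicator (hs i)]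

theorem prod_gaussianPDFReal_zero {ι : Type*} [Fintype ι] (v : ℝ≥0) (x : ι → ℝ) :
    ∏ i, gaussianPDFReal 0 v (x i) =
      (√(2 * π * v))⁻¹ ^ Fintype.card ι * exp (-(∑ i, x i ^ 2) / (2 * v)) := by
  simp only [gaussianPDFReal, Finset.prod_mul_distrib, Finset.prod_const, Finset.card_univ,
    sub_zero, ← Real.exp_sum, ← Finset.sum_div, Finset.sum_neg_distrib]

/-- The density formula for the product of centered Gaussian measures. -/
theorem pi_gaussianReal_real_apply {ι : Type*} [Fintype ι] {v : ℝ≥0} (hv : v ≠ 0)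
    {s : Set (ι → ℝ)} (hs : MeasurableSet s) :
    (Measure.pi fun _ : ι => gaussianReal 0 v).real s =
      ∫ x in s, (√(2 * π * v))⁻¹ ^ Fintype.card ι * exp (-(∑ i, x i ^ 2) / (2 * v)) := by
  have hdens : (Measure.pi fun _ : ι => gaussianReal 0 v) =
      (volume : Measure (ι → ℝ)).withDensity
        fun x => ENNReal.ofReal (∏ i, gaussianPDFReal 0 v (x i)) := by
    rw [volume_pi, ← pi_withDensity_ofReal (fun _ => volume) (fun _ => gaussianPDFReal 0 v)
      (fun _ => integrable_gaussianPDFReal 0 v) (fun _ => gaussianPDFReal_nonneg 0 v)]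
    simp only [gaussianReal_of_var_ne_zero 0 hv, gaussianPDF_def]
  have hint : Integrable (fun x : ι → ℝ => ∏ i, gaussianPDFReal 0 v (x i)) :=
    Integrable.fintype_prod fun _ => integrable_gaussianPDFReal 0 v
  rw [hdens, Measure.real, withDensity_apply _ hs, ← ofReal_integral_eq_lintegral_ofReal
    hint.integrableOn
    (ae_of_all _ fun x => Finset.prod_nonneg fun i _ => gaussianPDFReal_nonneg 0 v _),
    ENNReal.toReal_ofReal (integral_nonneg
      fun x => Finset.prod_nonneg fun i _ => gaussianPDFReal_nonneg 0 v _)]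
  simp_rw [prod_gaussianPDFReal_zero]

theorem integral_Ioi_mul_exp_neg_sq_div {v : ℝ} (hv : 0 < v) (r : ℝ) :
    IntegrableOn (fun y => y * exp (-y ^ 2 / (2 * v))) (Set.Ioi r) ∧
    ∫ y in Set.Ioi r, y * exp (-y ^ 2 / (2 * v)) = v * exp (-r ^ 2 / (2 * v)) := by
  have hint : Integrable (fun y : ℝ => y * exp (-y ^ 2 / (2 * v))) := by
    refine (integrable_mul_exp_neg_mul_sq (b := 1 / (2 * v)) (by positivity)).congr
      (ae_of_all _ fun y => ?_)
    simp only
    congr 2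
    ring
  have hderiv : ∀ y ∈ Set.Ici r, HasDerivAt (fun y => -v * exp (-y ^ 2 / (2 * v)))
      (y * exp (-y ^ 2 / (2 * v))) y := by
    intro y _
    have h := ((((hasDerivAt_pow 2 y).neg).div_const (2 * v)).exp).const_mul (-v)
    refine h.congr_deriv ?_
    simp
    field_simp
  have hlim : Filter.Tendsto (fun y => -v * exp (-y ^ 2 / (2 * v))) Filter.atTop (nhds 0) := by
    have h : Filter.Tendsto (fun y : ℝ => -y ^ 2 / (2 * v)) Filter.atTop Filter.atBot := by
      simp_rw [neg_div]
      exact Filter.tendsto_neg_atTop_atBot.comp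
        ((Filter.tendsto_pow_atTop two_ne_zero).atTop_div_const (by positivity))
    simpa using (tendsto_exp_atBot.comp h).const_mul (-v)
  refine ⟨hint.integrableOn, ?_⟩
  rw [integral_Ioi_of_hasDerivAt_of_tendsto' hderiv hint.integrableOn hlim]
  ring

/-- In dimension `2 (m + 1)`, the Gaussian mass outside a ball of radius `r` is at least the `m`-th
term of its Poisson-sum expression. -/
theorem le_pi_gaussianReal_real_sq_le_sum_sq {v : ℝ≥0} (hv : v ≠ 0) (m : ℕ) {r : ℝ}
    (hr : 0 ≤ r) :
    (r ^ 2 / (2 * v)) ^ m / m ! * exp (-r ^ 2 / (2 * v)) ≤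
      (Measure.pi fun _ : Fin (2 * (m + 1)) => gaussianReal 0 v).real
        {x | r ^ 2 ≤ ∑ i, x i ^ 2} := by
  have hv' : (0 : ℝ) < v := by positivity
  set C : ℝ := (√(2 * π * v))⁻¹ ^ (2 * (m + 1)) with hC
  have hCv : C = ((2 * π * v) ^ (m + 1))⁻¹ := by
    rw [hC, pow_mul, inv_pow, sq_sqrt (by positivity), inv_pow]
  have hC₀ : 0 ≤ C := by rw [hCv]; positivity
  set g : ℝ → ℝ := (Set.Ici r).indicator fun y => C * exp (-y ^ 2 / (2 * v)) with hg
  have hg₀ : ∀ y, 0 ≤ g y := fun y => Set.indicator_nonneg (fun y _ => by positivity) y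
  have hA : MeasurableSet {x : Fin (2 * (m + 1)) → ℝ | r ^ 2 ≤ ∑ i, x i ^ 2} :=
    measurableSet_le measurable_const (by fun_prop)
  have hnorm : ∀ x : Fin (2 * (m + 1)) → ℝ,
      {x : Fin (2 * (m + 1)) → ℝ | r ^ 2 ≤ ∑ i, x i ^ 2}.indicator
        (fun x => C * exp (-(∑ i, x i ^ 2) / (2 * v))) x = g ‖WithLp.toLp 2 x‖ := by
    intro x
    have hx : ‖WithLp.toLp 2 x‖ ^ 2 = ∑ i, x i ^ 2 := by
      simp [EuclideanSpace.norm_sq_eq]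
    simp only [hg, Set.indicator, Set.mem_ofPred_eq, Set.mem_Ici, ← hx,
      pow_le_pow_iff_left₀ hr (norm_nonneg _) two_ne_zero]
  have hpolar : (Measure.pi fun _ : Fin (2 * (m + 1)) => gaussianReal 0 v).real
        {x | r ^ 2 ≤ ∑ i, x i ^ 2} = (2 * (m + 1)) * (π ^ (m + 1) / (m + 1)!) *
          ∫ y in Set.Ioi 0, y ^ (2 * m + 1) * g y := by
    rw [pi_gaussianReal_real_apply hv hA, ← integral_indicator hA, Fintype.card_fin]
    simp_rw [← hC, hnorm]
    rw [(PiLp.volume_preserving_toLp (Fin (2 * (m + 1)))).integral_comp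
      (MeasurableEquiv.toLp 2 _).measurableEmbedding (fun x => g ‖x‖),
      integral_fun_norm_addHaar, Measure.real,
      InnerProductSpace.volume_ball_of_dim_even (k := m + 1) finrank_euclideanSpace_fin,
      finrank_euclideanSpace_fin]
    simp [ENNReal.toReal_ofReal (show 0 ≤ π ^ (m + 1) / (m + 1)! by positivity), mul_assoc,
      Nat.mul_add]
    ring
  have hgint : IntegrableOn (fun y => y ^ (2 * m + 1) * g y) (Set.Ioi 0) := by
    have hi : Integrable (fun x : EuclideanSpace ℝ (Fin (2 * (m + 1))) => g ‖x‖) := by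
      rw [← (PiLp.volume_preserving_toLp (Fin (2 * (m + 1)))).integrable_comp_emb
        (MeasurableEquiv.toLp 2 _).measurableEmbedding]
      simp only [Function.comp_def]
      simp_rw [← hnorm]
      refine Integrable.indicator ?_ hA
      have := Integrable.fintype_prod (ι := Fin (2 * (m + 1))) (μ := fun _ => volume)
        (f := fun _ => gaussianPDFReal 0 v) fun _ => integrable_gaussianPDFReal 0 v
      simp only [prod_gaussianPDFReal_zero, Fintype.card_fin] at this
      exact this
    simpa [Nat.mul_add] using (integrable_fun_norm_addHaar volume).1 hi
  obtain ⟨hint, hval⟩ := integral_Ioi_mul_exp_neg_sq_div hv' r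
  have hlow : r ^ (2 * m) * C * (v * exp (-r ^ 2 / (2 * v))) ≤
      ∫ y in Set.Ioi 0, y ^ (2 * m + 1) * g y := by
    rw [← hval, ← integral_const_mul]
    calc ∫ y in Set.Ioi r, r ^ (2 * m) * C * (y * exp (-y ^ 2 / (2 * v)))
        ≤ ∫ y in Set.Ioi r, y ^ (2 * m + 1) * g y := by
          refine setIntegral_mono_on (hint.const_mul _)
            (hgint.mono_set (Set.Ioi_subset_Ioi hr)) measurableSet_Ioi fun y hy => ?_
          have hy : r < y := hy
          have hy₀ : 0 ≤ y := hr.trans hy.le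
          rw [hg, Set.indicator_of_mem (Set.mem_Ici.2 hy.le)]
          calc r ^ (2 * m) * C * (y * exp (-y ^ 2 / (2 * v)))
              ≤ y ^ (2 * m) * C * (y * exp (-y ^ 2 / (2 * v))) := by gcongr
            _ = _ := by ring
      _ ≤ _ := setIntegral_mono_set hgint
          ((ae_restrict_iff' measurableSet_Ioi).2 (ae_of_all _ fun y hy =>
            mul_nonneg (pow_nonneg (le_of_lt hy) _) (hg₀ y)))
          (Set.Ioi_subset_Ioi hr).eventuallyLE
  rw [hpolar]
  refine le_trans (le_of_eq ?_) (mul_le_mul_of_nonneg_left hlow (by positivity))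
  rw [hCv, Nat.factorial_succ, div_pow, mul_pow, mul_pow, mul_pow, ← pow_mul]
  push_cast
  have := pi_pos
  field_simp
  ring

/-- An upper bound for the factorial matching Stirling's formula up to a constant. -/
theorem factorial_le_stirling {k : ℕ} (hk : 0 < k) :
    (k ! : ℝ) ≤ exp 1 * √k * (k / exp 1) ^ k := by
  obtain ⟨m, rfl⟩ : ∃ m, k = m + 1 := ⟨k - 1, by omega⟩
  have h := Stirling.stirlingSeq'_antitone (Nat.zero_le m)
  simp only [Function.comp_apply, Nat.succ_eq_add_one, zero_add, Stirling.stirlingSeq_one] at h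
  rw [Stirling.stirlingSeq] at h
  rw [div_le_iff₀ (by positivity)] at h
  refine h.trans (le_of_eq ?_)
  rw [sqrt_mul (by norm_num)]
  field_simp

/-- (Chi-squared lower tail bound.) Let `σ > 0`, let `n = 2k` be an even
positive integer, let `x⁽¹⁾, …, x⁽ⁿ⁾` be i.i.d. `N(0, σ²)` (modelled via the product of `n`
Gaussian measures), and let `x̄ = n⁻¹ Σᵢ (x⁽ⁱ⁾)²`. Then for every `ε ≥ 0`,
`Pr[x̄ ≥ σ² + ε] ≥ (1/(e²√(2n))) · exp(−n ε / (2σ²))`. -/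
theorem chiSquared_mean_tail_lower_bound (σ : ℝ) (hσ : 0 < σ)
    (k n : ℕ) (hk : 0 < k) (hn : n = 2 * k) (ε : ℝ) (hε : 0 ≤ ε) :
    ENNReal.ofReal
        (1 / (Real.exp 1 ^ 2 * Real.sqrt (2 * n)) * Real.exp (-(n * ε) / (2 * σ ^ 2))) ≤
      (Measure.pi fun _ : Fin n => gaussianReal 0 (σ ^ 2).toNNReal)
        {x | σ ^ 2 + ε ≤ (n : ℝ)⁻¹ * ∑ i, x i ^ 2} := by
  obtain ⟨m, rfl⟩ : ∃ m, k = m + 1 := ⟨k - 1, by omega⟩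
  subst hn
  have hv : (σ ^ 2).toNNReal ≠ 0 := by
    simpa using hσ.ne'
  have hvσ : ((σ ^ 2).toNNReal : ℝ) = σ ^ 2 := Real.coe_toNNReal _ (sq_nonneg σ)
  have hr : 0 ≤ 2 * ((m : ℝ) + 1) * (σ ^ 2 + ε) := by positivity
  have h := le_pi_gaussianReal_real_sq_le_sum_sq hv m 
    (sqrt_nonneg (2 * ((m : ℝ) + 1) * (σ ^ 2 + ε)))
  rw [sq_sqrt hr, hvσ] at h
  have hset : {x : Fin (2 * (m + 1)) → ℝ | σ ^ 2 + ε ≤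
      ((2 * (m + 1) : ℕ) : ℝ)⁻¹ * ∑ i, x i ^ 2} =
      {x | 2 * ((m : ℝ) + 1) * (σ ^ 2 + ε) ≤ ∑ i, x i ^ 2} := by
    ext x
    simp only [Set.mem_ofPred_eq]
    rw [le_inv_mul_iff₀ (by positivity)]
    push_cast
    rfl
  rw [hset, ENNReal.ofReal_le_iff_le_toReal (measure_ne_top _ _)]
  refine le_trans ?_ h
  have hexp : exp (-(2 * ((m : ℝ) + 1) * (σ ^ 2 + ε)) / (2 * σ ^ 2)) =
      (exp 1 ^ (m + 1))⁻¹ * exp (-((2 * (m + 1) : ℕ) * ε) / (2 * σ ^ 2)) := by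
    rw [← exp_nat_mul, ← exp_neg, ← exp_add]
    congr 1
    push_cast
    field_simp
    ring
  have hbase : ((m : ℝ) + 1) ≤ 2 * ((m : ℝ) + 1) * (σ ^ 2 + ε) / (2 * σ ^ 2) := by
    rw [le_div_iff₀ (by positivity)]
    nlinarith [mul_nonneg (by positivity : (0 : ℝ) ≤ m + 1) hε]
  rw [hexp, ← mul_assoc]
  refine mul_le_mul_of_nonneg_right ?_ (exp_pos _).le
  have hs := factorial_le_stirling (Nat.succ_pos m)
  have he : 1 ≤ exp 1 := one_le_exp zero_le_one
  have hsq : √((m : ℝ) + 1) ≤ √(2 * (2 * (m + 1) : ℕ)) :=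
    sqrt_le_sqrt (by push_cast; linarith [(m.cast_nonneg : (0 : ℝ) ≤ m)])
  calc 1 / (exp 1 ^ 2 * √(2 * (2 * (m + 1) : ℕ)))
      ≤ 1 / (exp 1 * √((m : ℝ) + 1)) := by
        gcongr
        nlinarith
    _ ≤ ((m : ℝ) + 1) ^ m / m ! * (exp 1 ^ (m + 1))⁻¹ := by
        rw [Nat.succ_eq_add_one, Nat.factorial_succ, div_pow] at hs
        push_cast at hs
        rw [pow_succ ((m : ℝ) + 1)] at hs
        have hs' : (m ! : ℝ) ≤ exp 1 * √((m : ℝ) + 1) * (((m : ℝ) + 1) ^ m / exp 1 ^ (m + 1)) := by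
          refine le_of_mul_le_mul_left (hs.trans_eq ?_) (by positivity : (0 : ℝ) < m + 1)
          ring
        rw [div_mul_eq_mul_div, ← div_eq_mul_inv, div_le_div_iff₀ (by positivity) (by positivity)]
        linarith
    _ ≤ _ := by gcongr
end

section
/- For every integer k ≥ 1 and every z ≥ 2k, the density p_{2k}(z) = z^{k−1} e^{−z/2} / (2^k (k−1)!) of the chi-squared distribution with 2k degrees of freedom satisfies p_{2k}(z) ≥ (1/(2 e² √k)) · e^{k − z/2}. -/
open Real Nat

/-- An explicit Stirling upper bound: `n! ≤ e √n (n / e) ^ n` for `n ≥ 1`. -/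
theorem factorial_le_exp_mul_sqrt_mul_pow {n : ℕ} (hn : n ≠ 0) :
    (n ! : ℝ) ≤ Real.exp 1 * √n * (n / Real.exp 1) ^ n := by
  obtain ⟨m, rfl⟩ := Nat.exists_eq_succ_of_ne_zero hn
  have h : Stirling.stirlingSeq (m + 1) ≤ Stirling.stirlingSeq 1 :=
    Stirling.stirlingSeq'_antitone (Nat.zero_le m)
  rw [Stirling.stirlingSeq_one, Stirling.stirlingSeq, div_le_iff₀ (by positivity),
    Real.sqrt_mul (by norm_num)] at h
  calc ((m + 1)! : ℝ) ≤ _ := h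
    _ = _ := by field_simp

/-- For every integer `k ≥ 1` and every `z ≥ 2k`, the density
`p_{2k}(z) = z^{k−1} e^{−z/2} / (2^k (k−1)!)` of the chi-squared distribution with `2k` degrees
of freedom satisfies `p_{2k}(z) ≥ (1/(2 e² √k)) · e^{k − z/2}`. -/
theorem chiSquared_density_lower_bound (k : ℕ) (hk : 1 ≤ k) (z : ℝ) (hz : 2 * (k : ℝ) ≤ z) :
    1 / (2 * Real.exp 1 ^ 2 * Real.sqrt k) * Real.exp (k - z / 2) ≤
      z ^ (k - 1) * Real.exp (-z / 2) / (2 ^ k * ((k - 1)! : ℝ)) := by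
  have hk0 : (0 : ℝ) < k := by exact_mod_cast hk
  have hz0 : 0 ≤ z := by linarith
  have hfac : (k ! : ℝ) = k * (k - 1)! := by
    exact_mod_cast (Nat.mul_factorial_pred (by omega)).symm
  have hpow : ∀ x : ℝ, x ^ k = x * x ^ (k - 1) := fun x => (mul_pow_sub_one (by omega) x).symm
  have hexp : Real.exp (k - z / 2) = Real.exp 1 ^ k * Real.exp (-z / 2) := by
    rw [← Real.exp_nat_mul, ← Real.exp_add]
    ring_nf
  have hstirling : ((k - 1)! : ℝ) * Real.exp 1 ^ k ≤ Real.exp 1 * √k * k ^ (k - 1) := by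
    have h := factorial_le_exp_mul_sqrt_mul_pow (n := k) (by omega)
    rw [hfac, div_pow, ← mul_div_assoc, le_div_iff₀ (by positivity), hpow (k : ℝ)] at h
    refine le_of_mul_le_mul_left ?_ hk0
    linarith
  have he : Real.exp 1 ≤ Real.exp 1 ^ 2 :=
    le_self_pow₀ (Real.one_le_exp zero_le_one) two_ne_zero
  have hmain : Real.exp 1 ^ k * (2 ^ k * ((k - 1)! : ℝ)) ≤
      z ^ (k - 1) * (2 * Real.exp 1 ^ 2 * √k) :=
    calc Real.exp 1 ^ k * (2 ^ k * ((k - 1)! : ℝ))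
        = 2 ^ k * ((k - 1)! * Real.exp 1 ^ k) := by ring
      _ ≤ 2 ^ k * (Real.exp 1 * √k * k ^ (k - 1)) := by gcongr
      _ = (2 * k) ^ (k - 1) * (2 * Real.exp 1 * √k) := by rw [hpow 2, mul_pow]; ring
      _ ≤ z ^ (k - 1) * (2 * Real.exp 1 ^ 2 * √k) := by gcongr
  rw [hexp, one_div_mul_eq_div, div_le_div_iff₀ (by positivity) (by positivity)]
  calc _ = Real.exp 1 ^ k * (2 ^ k * ((k - 1)! : ℝ)) * Real.exp (-z / 2) := by ring
    _ ≤ z ^ (k - 1) * (2 * Real.exp 1 ^ 2 * √k) * Real.exp (-z / 2) := by gcongr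
    _ = _ := by ring
end

section
/- Fix an integer T ≥ 1 and Euclidean spaces Θ = ℝ^{d_Θ} and S = ℝ^{d_S}. Let R : Θ × S → ℝ be Lipschitz with constant L_R and continuously differentiable with derivative ∇R that is Lipschitz with constant L_{∇R}; let f : Θ × S → S be Lipschitz with constant L_f and continuously differentiable with derivative ∇f that is Lipschitz with constant L_{∇f}; and let p be a probability measure on S with finite first moment ∫ ‖ζ‖ dp(ζ) < ∞. Define V^{(T)} = 0 and, for t < T, V^{(t)}(θ, s) = R(θ, s) + ∫ V^{(t+1)}(θ, f(θ, s) + ζ) dp(ζ). Let L̄_R = max{L_{∇R}, L_R, 1} and L̄_f = max{L_{∇f}, L_f, 1}. Then for every t < T, V^{(t)} is differentiable and its total derivative ∇V^{(t)} (with respect to (θ, s)) is Lipschitz continuous with constant at most 44 T⁵ L̄_R · L̄_f^{4(T−t−1)}. -/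
open MeasureTheory

section GradientBounds

variable {A B : Type*} [NormedAddCommGroup A] [NormedAddCommGroup B]

lemma norm_le_norm_fst_add_norm_snd (x : WithLp 2 (A × B)) : ‖x‖ ≤ ‖x.fst‖ + ‖x.snd‖ := by
  rw [← sq_le_sq₀ (norm_nonneg _) (by positivity), WithLp.prod_norm_sq_eq_of_L2]
  nlinarith [mul_nonneg (norm_nonneg x.fst) (norm_nonneg x.snd)]

/-- The weighted norm `n ‖θ‖ + ‖s‖`. -/
noncomputable def weightedNorm (n : ℕ) (x : WithLp 2 (A × B)) : ℝ := n * ‖x.fst‖ + ‖x.snd‖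

lemma weightedNorm_nonneg (n : ℕ) (x : WithLp 2 (A × B)) : 0 ≤ weightedNorm n x := by
  unfold weightedNorm; positivity

lemma weightedNorm_le (n : ℕ) (x : WithLp 2 (A × B)) : weightedNorm n x ≤ (n + 1) * ‖x‖ := by
  have h₁ := mul_le_mul_of_nonneg_left (WithLp.norm_fst_le _ x) (Nat.cast_nonneg (α := ℝ) n)
  have h₂ := WithLp.norm_snd_le _ x
  unfold weightedNorm; linarith

lemma norm_le_weightedNorm_succ (n : ℕ) (x : WithLp 2 (A × B)) :
    ‖x‖ ≤ weightedNorm (n + 1) x := by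
  refine (norm_le_norm_fst_add_norm_snd x).trans ?_
  unfold weightedNorm
  push_cast
  nlinarith [mul_nonneg (Nat.cast_nonneg (α := ℝ) n) (norm_nonneg x.fst)]

variable [NormedSpace ℝ A] [NormedSpace ℝ B]

/-- The inclusion of the second factor in an `ℓ²` product. -/
noncomputable def l2InrL (A B : Type*) [NormedAddCommGroup A] [NormedSpace ℝ A]
    [NormedAddCommGroup B] [NormedSpace ℝ B] : B →L[ℝ] WithLp 2 (A × B) :=
  (WithLp.prodContinuousLinearEquiv 2 ℝ A B).symm.toContinuousLinearMap ∘L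
    ContinuousLinearMap.inr ℝ A B

/-- The projection of an `ℓ²` product onto its first factor, as an endomorphism. -/
noncomputable def l2FstProjL (A B : Type*) [NormedAddCommGroup A] [NormedSpace ℝ A]
    [NormedAddCommGroup B] [NormedSpace ℝ B] : WithLp 2 (A × B) →L[ℝ] WithLp 2 (A × B) :=
  (WithLp.prodContinuousLinearEquiv 2 ℝ A B).symm.toContinuousLinearMap ∘L
    ContinuousLinearMap.inl ℝ A B ∘L WithLp.fstL 2 ℝ A B

lemma l2InrL_apply (v : B) : l2InrL A B v = WithLp.toLp 2 (0, v) := rfl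

lemma l2FstProjL_apply (x : WithLp 2 (A × B)) : l2FstProjL A B x = WithLp.toLp 2 (x.fst, 0) := rfl

lemma norm_l2InrL_apply (v : B) : ‖l2InrL A B v‖ = ‖v‖ := by
  rw [l2InrL_apply, WithLp.norm_toLp_snd]

lemma weightedNorm_transition_le {L : ℝ} (hL : 1 ≤ L) (n : ℕ) (x : WithLp 2 (A × B)) {v : B}
    (hv : ‖v‖ ≤ L * ‖x‖) :
    weightedNorm n (l2FstProjL A B x + l2InrL A B v) ≤ L * weightedNorm (n + 1) x := by
  have h := mul_le_mul_of_nonneg_left (norm_le_norm_fst_add_norm_snd x) (zero_le_one.trans hL)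
  have h' : n * ‖x.fst‖ ≤ L * (n * ‖x.fst‖) := le_mul_of_one_le_left (by positivity) hL
  simp only [weightedNorm, l2FstProjL_apply, l2InrL_apply, WithLp.add_fst, WithLp.add_snd,
    WithLp.toLp_fst, WithLp.toLp_snd, add_zero, zero_add]
  push_cast
  linarith

/-- `W` is differentiable with bounded derivative; its derivative in the second variable is bounded
by `b`, and its derivative is `h`-Lipschitz with respect to `weightedNorm n`. -/
structure HasGradientBounds (n : ℕ) (b h : ℝ) (W : WithLp 2 (A × B) → ℝ) : Prop where
  differentiable : Differentiable ℝ W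
  bounded : ∃ C, ∀ x, ‖fderiv ℝ W x‖ ≤ C
  apply_inr_le : ∀ x v, |fderiv ℝ W x (l2InrL A B v)| ≤ b * ‖v‖
  sub_apply_le : ∀ x y u, |fderiv ℝ W x u - fderiv ℝ W y u| ≤
    h * weightedNorm n (x - y) * weightedNorm n u

namespace HasGradientBounds

variable {n : ℕ} {b h : ℝ} {W : WithLp 2 (A × B) → ℝ}

lemma mono (hW : HasGradientBounds n b h W) {b' h' : ℝ} (hb : b ≤ b') (hh : h ≤ h') :
    HasGradientBounds n b' h' W where
  differentiable := hW.differentiable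
  bounded := hW.bounded
  apply_inr_le x v := (hW.apply_inr_le x v).trans (by gcongr)
  sub_apply_le x y u := (hW.sub_apply_le x y u).trans (by
    have := weightedNorm_nonneg n u
    have := weightedNorm_nonneg n (x - y)
    gcongr)

lemma norm_fderiv_sub_le (hW : HasGradientBounds n b h W) (hh : 0 ≤ h) (x y : WithLp 2 (A × B)) :
    ‖fderiv ℝ W x - fderiv ℝ W y‖ ≤ h * (n + 1) ^ 2 * ‖x - y‖ := by
  refine ContinuousLinearMap.opNorm_le_bound _ (by positivity) fun u => ?_
  rw [sub_apply, Real.norm_eq_abs]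
  calc |fderiv ℝ W x u - fderiv ℝ W y u|
      ≤ h * weightedNorm n (x - y) * weightedNorm n u := hW.sub_apply_le x y u
    _ ≤ h * ((n + 1) * ‖x - y‖) * ((n + 1) * ‖u‖) := by
      have := weightedNorm_nonneg n u
      gcongr <;> exact weightedNorm_le _ _
    _ = h * (n + 1) ^ 2 * ‖x - y‖ * ‖u‖ := by ring

lemma continuous_fderiv (hW : HasGradientBounds n b h W) (hh : 0 ≤ h) :
    Continuous (fderiv ℝ W) := by
  refine (LipschitzWith.of_dist_le_mul (K := (h * (n + 1) ^ 2).toNNReal) fun x y => ?_).continuous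
  rw [dist_eq_norm, dist_eq_norm, Real.coe_toNNReal _ (by positivity)]
  exact hW.norm_fderiv_sub_le hh x y

/-- Averaging over random translations of the second variable preserves gradient bounds. -/
lemma integral_translate [MeasurableSpace B] [BorelSpace B] [SecondCountableTopology B]
    {p : Measure B} [IsProbabilityMeasure p] (hp : Integrable (fun ζ => ‖ζ‖) p)
    (hW : HasGradientBounds n b h W) (hh : 0 ≤ h) :
    HasGradientBounds n b h (fun z => ∫ ζ, W (z + l2InrL A B ζ) ∂p) := by
  obtain ⟨C, hC⟩ := hW.bounded
  have hcont := hW.continuous_fderiv hh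
  have hmeas : ∀ z, AEStronglyMeasurable (fun ζ => W (z + l2InrL A B ζ)) p := fun z =>
    (hW.differentiable.continuous.comp
      (continuous_const.add (l2InrL A B).continuous)).aestronglyMeasurable
  have hmeas' : ∀ z, AEStronglyMeasurable (fun ζ => fderiv ℝ W (z + l2InrL A B ζ)) p := fun z =>
    (hcont.comp (continuous_const.add (l2InrL A B).continuous)).aestronglyMeasurable
  have hint' : ∀ z, Integrable (fun ζ => fderiv ℝ W (z + l2InrL A B ζ)) p := fun z =>
    (integrable_const C).mono' (hmeas' z) (.of_forall fun ζ => hC _)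
  have hint : ∀ z, Integrable (fun ζ => W (z + l2InrL A B ζ)) p := fun z => by
    refine ((integrable_const |W z|).add (hp.const_mul C)).mono' (hmeas z) (.of_forall fun ζ => ?_)
    have hlip := Convex.norm_image_sub_le_of_norm_fderiv_le (𝕜 := ℝ) (f := W)
      (fun x _ => hW.differentiable x) (fun x _ => hC x) convex_univ
      (Set.mem_univ z) (Set.mem_univ (z + l2InrL A B ζ))
    rw [add_sub_cancel_left, norm_l2InrL_apply] at hlip
    have := norm_add_le (W z) (W (z + l2InrL A B ζ) - W z)
    rw [add_sub_cancel, Real.norm_eq_abs (W z)] at this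
    exact this.trans (add_le_add_right hlip _)
  have hderiv : ∀ z, HasFDerivAt (fun z => ∫ ζ, W (z + l2InrL A B ζ) ∂p)
      (∫ ζ, fderiv ℝ W (z + l2InrL A B ζ) ∂p) z := fun z =>
    hasFDerivAt_integral_of_dominated_of_fderiv_le (bound := fun _ => C)
      (F' := fun z ζ => fderiv ℝ W (z + l2InrL A B ζ)) Filter.univ_mem
      (.of_forall hmeas) (hint z) (hmeas' z) (.of_forall fun ζ x _ => hC _) (integrable_const C)
      (.of_forall fun ζ x _ => (hW.differentiable (x + l2InrL A B ζ)).hasFDerivAt.comp x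
        ((hasFDerivAt_id x).add_const (l2InrL A B ζ)))
  have hfd : ∀ z, fderiv ℝ (fun z => ∫ ζ, W (z + l2InrL A B ζ) ∂p) z =
      ∫ ζ, fderiv ℝ W (z + l2InrL A B ζ) ∂p := fun z => (hderiv z).fderiv
  have happ : ∀ z u, fderiv ℝ (fun z => ∫ ζ, W (z + l2InrL A B ζ) ∂p) z u =
      ∫ ζ, fderiv ℝ W (z + l2InrL A B ζ) u ∂p := fun z u => by
    rw [hfd, ContinuousLinearMap.integral_apply (hint' z)]
  refine ⟨fun z => (hderiv z).differentiableAt, ⟨C, fun z => ?_⟩, fun z v => ?_, fun x y u => ?_⟩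
  · rw [hfd]
    simpa using norm_integral_le_of_norm_le_const (μ := p)
      (.of_forall fun ζ => hC (z + l2InrL A B ζ))
  · rw [happ]
    have hbound : ∀ ζ, ‖fderiv ℝ W (z + l2InrL A B ζ) (l2InrL A B v)‖ ≤ b * ‖v‖ := fun ζ =>
      hW.apply_inr_le (z + l2InrL A B ζ) v
    simpa using norm_integral_le_of_norm_le_const (μ := p) (.of_forall hbound)
  · rw [happ, happ, ← integral_sub ((hint' x).apply_continuousLinearMap u)
      ((hint' y).apply_continuousLinearMap u)]
    have hsub : ∀ ζ, ‖fderiv ℝ W (x + l2InrL A B ζ) u - fderiv ℝ W (y + l2InrL A B ζ) u‖ ≤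
        h * weightedNorm n (x - y) * weightedNorm n u := fun ζ => by
      simpa using hW.sub_apply_le (x + l2InrL A B ζ) (y + l2InrL A B ζ) u
    simpa using norm_integral_le_of_norm_le_const (μ := p) (.of_forall hsub)

/-- Gradient bounds for one step of the deterministic dynamics `(θ, s) ↦ (θ, f (θ, s))`. -/
lemma add_comp {R : WithLp 2 (A × B) → ℝ} {f : WithLp 2 (A × B) → B} {M L : ℝ}
    (hM : 0 ≤ M) (hL : 1 ≤ L) (hh : 0 ≤ h)
    (hR : Differentiable ℝ R) (hRb : ∀ x, ‖fderiv ℝ R x‖ ≤ M)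
    (hRgrad : ∀ x y, ‖fderiv ℝ R x - fderiv ℝ R y‖ ≤ M * ‖x - y‖)
    (hf : Differentiable ℝ f) (hfb : ∀ x, ‖fderiv ℝ f x‖ ≤ L)
    (hflip : ∀ x y, ‖f x - f y‖ ≤ L * ‖x - y‖)
    (hfgrad : ∀ x y, ‖fderiv ℝ f x - fderiv ℝ f y‖ ≤ L * ‖x - y‖)
    (hb : 0 ≤ b) (hW : HasGradientBounds n b h W) :
    HasGradientBounds (n + 1) (M + L * b) (M + L * b + L ^ 2 * h)
      (fun x => R x + W (l2FstProjL A B x + l2InrL A B (f x))) := by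
  set G : WithLp 2 (A × B) → WithLp 2 (A × B) :=
    fun x => l2FstProjL A B x + l2InrL A B (f x) with hG
  have hL0 : 0 ≤ L := zero_le_one.trans hL
  obtain ⟨C, hC⟩ := hW.bounded
  have hC0 : 0 ≤ C := (norm_nonneg _).trans (hC 0)
  have hderiv : ∀ x, HasFDerivAt (fun x => R x + W (G x))
      (fderiv ℝ R x + fderiv ℝ W (G x) ∘L
        (l2FstProjL A B + l2InrL A B ∘L fderiv ℝ f x)) x := fun x =>
    (hR x).hasFDerivAt.add ((hW.differentiable (G x)).hasFDerivAt.comp x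
      ((l2FstProjL A B).hasFDerivAt.add
        ((l2InrL A B).hasFDerivAt.comp x (hf x).hasFDerivAt)))
  have happ : ∀ x u, fderiv ℝ (fun x => R x + W (G x)) x u = fderiv ℝ R x u +
      fderiv ℝ W (G x) (l2FstProjL A B u + l2InrL A B (fderiv ℝ f x u)) := fun x u => by
    rw [(hderiv x).fderiv]; rfl
  have hfu : ∀ x u, ‖fderiv ℝ f x u‖ ≤ L * ‖u‖ := fun x =>
    (fderiv ℝ f x).le_of_opNorm_le (hfb x)
  refine ⟨fun x => (hderiv x).differentiableAt,
    ⟨M + C * (‖l2FstProjL A B‖ + ‖l2InrL A B‖ * L), fun x => ?_⟩, fun x v => ?_, fun x y u => ?_⟩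
  · rw [(hderiv x).fderiv]
    refine (norm_add_le _ _).trans (add_le_add (hRb x) ?_)
    refine (ContinuousLinearMap.opNorm_comp_le _ _).trans ?_
    gcongr
    · exact hC _
    · refine (norm_add_le _ _).trans ?_
      gcongr
      refine (ContinuousLinearMap.opNorm_comp_le _ _).trans ?_
      gcongr
      exact hfb x
  · have hz : l2FstProjL A B (l2InrL A B v) = 0 := rfl
    rw [happ, hz, zero_add]
    have h₁ := (fderiv ℝ R x).le_of_opNorm_le (hRb x) (l2InrL A B v)
    have h₂ := hfu x (l2InrL A B v)
    rw [norm_l2InrL_apply] at h₁ h₂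
    have h₃ := (hW.apply_inr_le (G x) (fderiv ℝ f x (l2InrL A B v))).trans
      (mul_le_mul_of_nonneg_left h₂ hb)
    refine (abs_add_le _ _).trans ((add_le_add h₁ h₃).trans_eq (by ring))
  · set D : WithLp 2 (A × B) := l2FstProjL A B u + l2InrL A B (fderiv ℝ f y u)
    have hsplit : fderiv ℝ (fun x => R x + W (G x)) x u - fderiv ℝ (fun x => R x + W (G x)) y u =
        (fderiv ℝ R x - fderiv ℝ R y) u +
        fderiv ℝ W (G x) (l2InrL A B ((fderiv ℝ f x - fderiv ℝ f y) u)) +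
        (fderiv ℝ W (G x) D - fderiv ℝ W (G y) D) := by
      simp only [happ, D, sub_apply, map_add, map_sub]
      ring
    have h₁ := (fderiv ℝ R x - fderiv ℝ R y).le_of_opNorm_le (hRgrad x y) u
    have h₂ := (hW.apply_inr_le (G x) ((fderiv ℝ f x - fderiv ℝ f y) u)).trans
      (mul_le_mul_of_nonneg_left
        ((fderiv ℝ f x - fderiv ℝ f y).le_of_opNorm_le (hfgrad x y) u) hb)
    have hGsub : G x - G y = l2FstProjL A B (x - y) + l2InrL A B (f x - f y) := by
      simp only [hG, map_sub]; abel
    have h₃ := hW.sub_apply_le (G x) (G y) D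
    have hnG : weightedNorm n (G x - G y) ≤ L * weightedNorm (n + 1) (x - y) := by
      rw [hGsub]; exact weightedNorm_transition_le hL n _ (hflip x y)
    have hnD : weightedNorm n D ≤ L * weightedNorm (n + 1) u :=
      weightedNorm_transition_le hL n _ (hfu y u)
    have hnx := weightedNorm_nonneg (n + 1) (x - y)
    have hnD0 := weightedNorm_nonneg n D
    have hxy := norm_le_weightedNorm_succ n (x - y)
    have hu := norm_le_weightedNorm_succ n u
    rw [hsplit]
    calc _ ≤ M * ‖x - y‖ * ‖u‖ + b * (L * ‖x - y‖ * ‖u‖) +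
          h * weightedNorm n (G x - G y) * weightedNorm n D :=
        (abs_add_le _ _).trans (add_le_add ((abs_add_le _ _).trans (add_le_add h₁ h₂)) h₃)
      _ ≤ M * weightedNorm (n + 1) (x - y) * weightedNorm (n + 1) u +
          b * (L * weightedNorm (n + 1) (x - y) * weightedNorm (n + 1) u) +
          h * (L * weightedNorm (n + 1) (x - y)) * (L * weightedNorm (n + 1) u) := by
        gcongr
      _ = _ := by ring

lemma zero : HasGradientBounds 0 0 0 (fun _ : WithLp 2 (A × B) => (0 : ℝ)) where
  differentiable := differentiable_const 0
  bounded := ⟨0, fun x => by simp⟩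
  apply_inr_le x v := by simp
  sub_apply_le x y u := by simp

end HasGradientBounds

end GradientBounds

/-- (Lipschitz constant of the gradient of the value functions.) Work on
`E = Θ ×₂ S` (the product with the Euclidean norm). Let `R : E → ℝ` be `L_R`-Lipschitz and
continuously differentiable with `L_{∇R}`-Lipschitz derivative, let `f : E → S` be
`L_f`-Lipschitz and continuously differentiable with `L_{∇f}`-Lipschitz derivative, and let `p`
be a probability measure on `S` with finite first moment. Define `V^{(T)} = 0` and
`V^{(t)}(θ,s) = R(θ,s) + ∫ V^{(t+1)}(θ, f(θ,s) + ζ) dp(ζ)` for `t < T`. Then each `V^{(t)}`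
(`t < T`) is differentiable with total derivative Lipschitz with constant at most
`44 T⁵ L̄_R L̄_f^{4(T−t−1)}`, where `L̄_R = max{L_{∇R}, L_R, 1}`, `L̄_f = max{L_{∇f}, L_f, 1}`. -/
theorem value_function_gradient_lipschitz {dΘ dS : ℕ} (T : ℕ) (hT : 1 ≤ T)
    (R : WithLp 2 (EuclideanSpace ℝ (Fin dΘ) × EuclideanSpace ℝ (Fin dS)) → ℝ)
    (f : WithLp 2 (EuclideanSpace ℝ (Fin dΘ) × EuclideanSpace ℝ (Fin dS)) →
      EuclideanSpace ℝ (Fin dS))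
    (LR LdR Lf Ldf : ℝ)
    (hRlip : ∀ x y, |R x - R y| ≤ LR * ‖x - y‖)
    (hRdiff : ContDiff ℝ 1 R)
    (hRgrad : ∀ x y, ‖fderiv ℝ R x - fderiv ℝ R y‖ ≤ LdR * ‖x - y‖)
    (hflip : ∀ x y, ‖f x - f y‖ ≤ Lf * ‖x - y‖)
    (hfdiff : ContDiff ℝ 1 f)
    (hfgrad : ∀ x y, ‖fderiv ℝ f x - fderiv ℝ f y‖ ≤ Ldf * ‖x - y‖)
    (p : Measure (EuclideanSpace ℝ (Fin dS))) [IsProbabilityMeasure p]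
    (hp : Integrable (fun ζ => ‖ζ‖) p)
    (V : ℕ → WithLp 2 (EuclideanSpace ℝ (Fin dΘ) × EuclideanSpace ℝ (Fin dS)) → ℝ)
    (hVT : ∀ x, V T x = 0)
    (hVrec : ∀ t < T, ∀ x, V t x = R x +
      ∫ ζ, V (t + 1)
        ((WithLp.equiv 2 (EuclideanSpace ℝ (Fin dΘ) × EuclideanSpace ℝ (Fin dS))).symm
          ((WithLp.equiv 2 (EuclideanSpace ℝ (Fin dΘ) × EuclideanSpace ℝ (Fin dS)) x).1,
            f x + ζ)) ∂p) :
    ∀ t < T, Differentiable ℝ (V t) ∧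
      ∀ x y, ‖fderiv ℝ (V t) x - fderiv ℝ (V t) y‖ ≤
        44 * (T : ℝ) ^ 5 * max (max LdR LR) 1 *
          (max (max Ldf Lf) 1) ^ (4 * (T - t - 1)) * ‖x - y‖ := by
  set M : ℝ := max (max LdR LR) 1 with hMdef
  set L : ℝ := max (max Ldf Lf) 1 with hLdef
  have hM : 0 ≤ M := zero_le_one.trans (le_max_right _ _)
  have hL : 1 ≤ L := le_max_right _ _
  have hL0 : 0 ≤ L := zero_le_one.trans hL
  have hLR : LR ≤ M := (le_max_right _ _).trans (le_max_left _ _)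
  have hLdR : LdR ≤ M := (le_max_left _ _).trans (le_max_left _ _)
  have hLf : Lf ≤ L := (le_max_right _ _).trans (le_max_left _ _)
  have hLdf : Ldf ≤ L := (le_max_left _ _).trans (le_max_left _ _)
  have hflip' : ∀ x y, ‖f x - f y‖ ≤ L * ‖x - y‖ := fun x y => (hflip x y).trans (by gcongr)
  have key : ∀ n ≤ T, HasGradientBounds n (M * n * L ^ (n - 1))
      (M * n ^ 2 * L ^ (2 * (n - 1))) (V (T - n)) := by
    intro n
    induction n with
    | zero =>
      intro _
      rw [Nat.sub_zero, funext hVT]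
      simpa using HasGradientBounds.zero
    | succ n ih =>
      intro hn
      have ht : T - (n + 1) + 1 = T - n := by omega
      have hV : V (T - (n + 1)) = fun x => R x + ∫ ζ, V (T - n)
          (l2FstProjL _ _ x + l2InrL _ _ (f x) + l2InrL _ _ ζ) ∂p := by
        funext x
        rw [hVrec _ (by omega), ht]
        congr! 4 with ζ
        simp only [l2FstProjL_apply, l2InrL_apply, ← WithLp.toLp_add, Prod.mk_add_mk, add_zero,
          zero_add]
        rfl
      rw [hV]
      refine (((ih (by omega)).integral_translate hp (by positivity)).add_comp (R := R) (f := f)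
        hM hL (by positivity) (hRdiff.differentiable one_ne_zero) (fun x => ?_) (fun x y => ?_)
        (hfdiff.differentiable one_ne_zero) (fun x => ?_) hflip' (fun x y => ?_)
        (by positivity)).mono ?_ ?_
      · exact norm_fderiv_le_of_lip' ℝ hM (.of_forall fun y => (hRlip y x).trans (by gcongr))
      · exact (hRgrad x y).trans (by gcongr)
      · exact norm_fderiv_le_of_lip' ℝ hL0 (.of_forall fun y => hflip' y x)
      · exact (hfgrad x y).trans (by gcongr)
      · rcases n with _ | m
        · simp
        · have h₁ : M ≤ M * L ^ (m + 1) := le_mul_of_one_le_right hM (one_le_pow₀ hL)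
          simp only [Nat.add_sub_cancel]
          push_cast
          linear_combination h₁
      · rcases n with _ | m
        · simp
        · have h₁ : M ≤ M * L ^ (2 * (m + 1)) := le_mul_of_one_le_right hM (one_le_pow₀ hL)
          have h₂ : L ^ (m + 1) ≤ L ^ (2 * (m + 1)) := pow_le_pow_right₀ hL (by omega)
          have h₃ : M * (m + 1) * L ^ (m + 1) ≤ M * (m + 1) * L ^ (2 * (m + 1)) := by gcongr
          have h₄ : 0 ≤ M * (m + 1) * L ^ (2 * (m + 1)) := by positivity
          simp only [Nat.add_sub_cancel]
          push_cast
          linear_combination h₁ + h₃ + h₄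
  intro t ht
  have hW := key (T - t) (by omega)
  rw [show T - (T - t) = t by omega] at hW
  refine ⟨hW.differentiable, fun x y => (hW.norm_fderiv_sub_le (by positivity) x y).trans ?_⟩
  gcongr ?_ * _
  have hnT : ((T - t : ℕ) : ℝ) ≤ T := by exact_mod_cast Nat.sub_le T t
  have hT1 : (1 : ℝ) ≤ T := by exact_mod_cast hT
  have hpow : L ^ (2 * (T - t - 1)) ≤ L ^ (4 * (T - t - 1)) := pow_le_pow_right₀ hL (by omega)
  have hpoly : (T : ℝ) ^ 2 * (T + 1) ^ 2 ≤ 44 * (T : ℝ) ^ 5 := by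
    calc (T : ℝ) ^ 2 * (T + 1) ^ 2 ≤ (T : ℝ) ^ 2 * (T + T) ^ 2 := by gcongr
      _ = 4 * (T : ℝ) ^ 4 := by ring
      _ ≤ 44 * (T : ℝ) ^ 5 := by
        gcongr
        all_goals norm_num
  calc M * ((T - t : ℕ) : ℝ) ^ 2 * L ^ (2 * (T - t - 1)) * (((T - t : ℕ) : ℝ) + 1) ^ 2
      ≤ M * (T : ℝ) ^ 2 * L ^ (4 * (T - t - 1)) * ((T : ℝ) + 1) ^ 2 := by gcongr
    _ = (T : ℝ) ^ 2 * (T + 1) ^ 2 * M * L ^ (4 * (T - t - 1)) := by ring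
    _ ≤ 44 * (T : ℝ) ^ 5 * M * L ^ (4 * (T - t - 1)) := by gcongr
end

section
/- Fix an integer T ≥ 1 and Euclidean spaces Θ = ℝ^{d_Θ} and S = ℝ^{d_S}. Let R : Θ × S → ℝ and f : Θ × S → S be Lipschitz, and let p be a probability measure on S with finite first moment M = ∫ ‖ζ‖ dp(ζ) < ∞. Define V^{(T)} = 0 and, for t < T, V^{(t)}(θ, s) = R(θ, s) + ∫ V^{(t+1)}(θ, f(θ, s) + ζ) dp(ζ). Suppose that for each t ∈ {0, …, T}, the function s ↦ V^{(t)}(θ, s) is Lipschitz with constant L^{(t)} uniformly in θ. Fix ζ_0, …, ζ_{T−1} ∈ S and define V̂^{(T)} = 0 and, for t < T, V̂^{(t)}(θ, s) = R(θ, s) + V̂^{(t+1)}(θ, f(θ, s) + ζ_t). Then for every t ∈ {0, …, T}, every θ ∈ Θ, and every s ∈ S, |V̂^{(t)}(θ, s) − V^{(t)}(θ, s)| ≤ Σ_{i=t}^{T−1} L^{(i+1)} · (‖ζ_i‖ + M). -/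
open MeasureTheory

/-- A Lipschitz function at a translate by `a` differs from its average over random translates
by at most the Lipschitz constant times `‖a‖` plus the first moment. -/
lemma abs_apply_add_sub_integral_le {E : Type*} [NormedAddCommGroup E] [MeasurableSpace E]
    [BorelSpace E] [SecondCountableTopology E] (p : Measure E) [IsProbabilityMeasure p]
    (hp : Integrable (fun z => ‖z‖) p) {g : E → ℝ} {K : ℝ}
    (hg : ∀ x y, |g x - g y| ≤ K * ‖x - y‖) (x a : E) :
    |g (x + a) - ∫ z, g (x + z) ∂p| ≤ K * (‖a‖ + ∫ z, ‖z‖ ∂p) := by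
  have hK (y : E) : 0 ≤ K * ‖y‖ := by
    simpa using (abs_nonneg _).trans (hg y 0)
  have hcont : Continuous g := by
    refine (LipschitzWith.of_dist_le_mul (K := K.toNNReal) fun y z => ?_).continuous
    rw [Real.dist_eq, dist_eq_norm]
    exact (hg y z).trans
      (mul_le_mul_of_nonneg_right (Real.le_coe_toNNReal K) (norm_nonneg _))
  have hbound (z : E) : ‖g (x + a) - g (x + z)‖ ≤ K * (‖a‖ + ‖z‖) := by
    rw [Real.norm_eq_abs]
    refine (hg _ _).trans ?_
    rw [add_sub_add_left_eq_sub]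
    rcases le_total 0 K with h | h
    · exact mul_le_mul_of_nonneg_left (norm_sub_le a z) h
    · have := mul_nonpos_of_nonpos_of_nonneg h (norm_nonneg (a - z))
      linarith [hK a, hK z]
  have hmaj : Integrable (fun z => K * (‖a‖ + ‖z‖)) p :=
    ((integrable_const _).add hp).const_mul K
  have hdiff : Integrable (fun z => g (x + a) - g (x + z)) p :=
    hmaj.mono' (by fun_prop) (.of_forall hbound)
  have hint : Integrable (fun z => g (x + z)) p := by
    simpa [Pi.sub_def] using (integrable_const (g (x + a))).sub hdiff
  calc |g (x + a) - ∫ z, g (x + z) ∂p|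
      = ‖∫ z, (g (x + a) - g (x + z)) ∂p‖ := by
        rw [integral_sub (integrable_const _) hint]; simp
    _ ≤ ∫ z, K * (‖a‖ + ‖z‖) ∂p :=
        norm_integral_le_of_norm_le hmaj (.of_forall hbound)
    _ = K * (‖a‖ + ∫ z, ‖z‖ ∂p) := by
        rw [integral_const_mul, integral_add (integrable_const _) hp]; simp

/-- (Deviation of the single-rollout value estimate.) Let `R` and `f` be
Lipschitz, let `p` be a probability measure on `S` with finite first moment `M = ∫ ‖ζ‖ dp`, and
define the expected value functions by `V^{(T)} = 0` and
`V^{(t)}(θ,s) = R(θ,s) + ∫ V^{(t+1)}(θ, f(θ,s) + ζ) dp(ζ)`. Suppose `s ↦ V^{(t)}(θ,s)` is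
`L^{(t)}`-Lipschitz uniformly in `θ`. Fix noise realizations `ζ_0, …, ζ_{T−1}` and define the
stochastic approximation `V̂^{(T)} = 0`, `V̂^{(t)}(θ,s) = R(θ,s) + V̂^{(t+1)}(θ, f(θ,s) + ζ_t)`.
Then `|V̂^{(t)}(θ,s) − V^{(t)}(θ,s)| ≤ Σ_{i=t}^{T−1} L^{(i+1)} (‖ζ_i‖ + M)`. -/
theorem value_estimate_deviation {dΘ dS : ℕ} (T : ℕ) (hT : 1 ≤ T)
    (R : EuclideanSpace ℝ (Fin dΘ) → EuclideanSpace ℝ (Fin dS) → ℝ)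
    (f : EuclideanSpace ℝ (Fin dΘ) → EuclideanSpace ℝ (Fin dS) → EuclideanSpace ℝ (Fin dS))
    (LR Lf : ℝ)
    (hR : ∀ θ θ' s s', |R θ s - R θ' s'| ≤ LR * Real.sqrt (‖θ - θ'‖ ^ 2 + ‖s - s'‖ ^ 2))
    (hf : ∀ θ θ' s s', ‖f θ s - f θ' s'‖ ≤ Lf * Real.sqrt (‖θ - θ'‖ ^ 2 + ‖s - s'‖ ^ 2))
    (p : Measure (EuclideanSpace ℝ (Fin dS))) [IsProbabilityMeasure p]
    (hp : Integrable (fun ζ => ‖ζ‖) p)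
    (V : ℕ → EuclideanSpace ℝ (Fin dΘ) → EuclideanSpace ℝ (Fin dS) → ℝ)
    (hVT : ∀ θ s, V T θ s = 0)
    (hVrec : ∀ t < T, ∀ θ s, V t θ s = R θ s + ∫ ζ, V (t + 1) θ (f θ s + ζ) ∂p)
    (L : ℕ → ℝ)
    (hL : ∀ t ≤ T, ∀ θ s s', |V t θ s - V t θ s'| ≤ L t * ‖s - s'‖)
    (ζ : ℕ → EuclideanSpace ℝ (Fin dS))
    (Vhat : ℕ → EuclideanSpace ℝ (Fin dΘ) → EuclideanSpace ℝ (Fin dS) → ℝ)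
    (hVhatT : ∀ θ s, Vhat T θ s = 0)
    (hVhatrec : ∀ t < T, ∀ θ s, Vhat t θ s = R θ s + Vhat (t + 1) θ (f θ s + ζ t)) :
    ∀ t ≤ T, ∀ θ s,
      |Vhat t θ s - V t θ s| ≤
        ∑ i ∈ Finset.Ico t T, L (i + 1) * (‖ζ i‖ + ∫ z, ‖z‖ ∂p) := by
  intro t ht
  induction ht using Nat.decreasingInduction with
  | self => intro θ s; simp [hVT, hVhatT]
  | of_succ t ht ih =>
    intro θ s
    rw [hVhatrec t ht, hVrec t ht, Finset.sum_eq_sum_Ico_succ_bot ht, add_sub_add_left_eq_sub,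
      add_comm (L (t + 1) * _)]
    exact (abs_sub_le _ (V (t + 1) θ (f θ s + ζ t)) _).trans (add_le_add (ih θ _)
      (abs_apply_add_sub_integral_le p hp (hL (t + 1) ht θ) (f θ s) (ζ t)))
end

section
/- Let σ, ε > 0 and 0 < δ ≤ 1/2, let x^{(1)}, …, x^{(n)} be i.i.d. Gaussian random variables with mean 0 and variance σ², and let x̄ = n^{-1} Σ_{i=1}^n x^{(i)} be their empirical mean. If n < σ² (log√(e/(2π)) + log(1/δ)) / ε², then Pr[|x̄| ≥ ε] > δ. In particular, the number of samples needed to estimate the mean to within ε with probability at least 1 − δ is at least σ² (log√(e/(2π)) + log(1/δ)) / ε². -/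
open MeasureTheory ProbabilityTheory Real

open Set Filter Topology in
lemma integrableOn_and_integral_Ioi_mul_exp_neg_sq_div {v : ℝ} (hv : 0 < v) {a : ℝ} (ha : 0 ≤ a) :
    IntegrableOn (fun x => x / v * exp (-x ^ 2 / v)) (Ioi a) ∧
      ∫ x in Ioi a, x / v * exp (-x ^ 2 / v) = exp (-a ^ 2 / v) / 2 := by
  have hderiv : ∀ x ∈ Ici a,
      HasDerivAt (fun x : ℝ => -(exp (-x ^ 2 / v) / 2)) (x / v * exp (-x ^ 2 / v)) x := by
    intro x _
    have := (((((hasDerivAt_id x).pow 2).neg.div_const v).exp).div_const 2).neg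
    convert! this using 1
    simp
    ring
  have hnonneg : ∀ x ∈ Ioi a, 0 ≤ x / v * exp (-x ^ 2 / v) := fun x hx =>
    mul_nonneg (div_nonneg (ha.trans (le_of_lt hx)) hv.le) (exp_pos _).le
  have hlim : Tendsto (fun x : ℝ => -(exp (-x ^ 2 / v) / 2)) atTop (𝓝 0) := by
    have h1 : Tendsto (fun x : ℝ => -x ^ 2 / v) atTop atBot :=
      (tendsto_neg_atTop_atBot.comp (tendsto_pow_atTop two_ne_zero)).atBot_div_const hv
    simpa using ((tendsto_exp_atBot.comp h1).div_const 2).neg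
  refine ⟨integrableOn_Ioi_deriv_of_nonneg' hderiv hnonneg hlim, ?_⟩
  rw [integral_Ioi_of_hasDerivAt_of_nonneg' hderiv hnonneg hlim]
  ring

lemma mul_exp_neg_sq_div_le_gaussianPDFReal {v : NNReal} (hv : v ≠ 0) (x : ℝ) :
    √(exp 1 / (2 * π)) * (x / v * exp (-x ^ 2 / v)) ≤ gaussianPDFReal 0 v x := by
  have hv' : (0 : ℝ) < v := by positivity
  have hs : (√(v : ℝ)) ^ 2 = v := sq_sqrt hv'.le
  have hs0 : 0 < √(v : ℝ) := sqrt_pos.2 hv'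
  set s := √(v : ℝ) with hs_def
  have key : x / s ≤ exp (x ^ 2 / (2 * v) - 1 / 2) := by
    refine le_trans ?_ (add_one_le_exp _)
    have : x ^ 2 / (2 * v) = (x / s) ^ 2 / 2 := by rw [div_pow, hs]; ring
    rw [this]
    nlinarith [sq_nonneg (x / s - 1)]
  have he : √(exp 1) = exp (1 / 2) := by
    rw [← exp_half]
  have h1 : gaussianPDFReal 0 v x =
      (√(2 * π))⁻¹ * s⁻¹ * exp (1 / 2) * exp (-x ^ 2 / v) * exp (x ^ 2 / (2 * v) - 1 / 2) := by
    have hexp : exp (-(x - 0) ^ 2 / (2 * v)) =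
        exp (1 / 2) * exp (-x ^ 2 / v) * exp (x ^ 2 / (2 * v) - 1 / 2) := by
      rw [← exp_add, ← exp_add]
      congr 1
      field_simp
      ring
    rw [gaussianPDFReal, sqrt_mul (by positivity), mul_inv, hexp]
    ring
  have h2 : √(exp 1 / (2 * π)) * (x / v * exp (-x ^ 2 / v)) =
      (√(2 * π))⁻¹ * s⁻¹ * exp (1 / 2) * exp (-x ^ 2 / v) * (x / s) := by
    have : x / (v : ℝ) = s⁻¹ * (x / s) := by rw [← hs]; field_simp
    rw [sqrt_div (exp_pos 1).le, he, this]
    ring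
  rw [h1, h2]
  gcongr

lemma le_gaussianReal_Ioi {v : NNReal} (hv : v ≠ 0) {a : ℝ} (ha : 0 ≤ a) :
    ENNReal.ofReal (√(exp 1 / (2 * π)) * exp (-a ^ 2 / v) / 2) ≤
      gaussianReal 0 v (Set.Ioi a) := by
  obtain ⟨hint, heq⟩ :=
    integrableOn_and_integral_Ioi_mul_exp_neg_sq_div (v := v) (by positivity) ha
  rw [gaussianReal_apply_eq_integral 0 hv, mul_div_assoc, ← heq, ← integral_const_mul]
  exact ENNReal.ofReal_le_ofReal <| setIntegral_mono (hint.const_mul _)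
    (integrable_gaussianPDFReal 0 v).integrableOn (mul_exp_neg_sq_div_le_gaussianPDFReal hv)

lemma le_gaussianReal_le_abs {v : NNReal} (hv : v ≠ 0) {a : ℝ} (ha : 0 ≤ a) :
    ENNReal.ofReal (√(exp 1 / (2 * π)) * exp (-a ^ 2 / v)) ≤
      gaussianReal 0 v {x | a ≤ |x|} := by
  have hneg : gaussianReal 0 v (Set.Iio (-a)) = gaussianReal 0 v (Set.Ioi a) := by
    have h := gaussianReal_map_neg (μ := 0) (v := v)
    rw [neg_zero] at h
    conv_lhs => rw [← h, Measure.map_apply measurable_neg measurableSet_Iio]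
    simp
  have hdisj : Disjoint (Set.Iio (-a)) (Set.Ioi a) :=
    Set.Iio_disjoint_Ioi_of_le (by linarith)
  calc ENNReal.ofReal (√(exp 1 / (2 * π)) * exp (-a ^ 2 / v))
      = ENNReal.ofReal (√(exp 1 / (2 * π)) * exp (-a ^ 2 / v) / 2) +
          ENNReal.ofReal (√(exp 1 / (2 * π)) * exp (-a ^ 2 / v) / 2) := by
        rw [← ENNReal.ofReal_add (by positivity) (by positivity), add_halves]
    _ ≤ gaussianReal 0 v (Set.Iio (-a)) + gaussianReal 0 v (Set.Ioi a) := by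
        rw [hneg]
        gcongr <;> exact le_gaussianReal_Ioi hv ha
    _ = gaussianReal 0 v (Set.Iio (-a) ∪ Set.Ioi a) :=
        (measure_union hdisj measurableSet_Ioi).symm
    _ ≤ gaussianReal 0 v {x | a ≤ |x|} := by
        refine measure_mono ?_
        rintro x (hx | hx)
        · exact le_abs.2 (Or.inr (le_neg_of_le_neg (Set.mem_Iio.1 hx).le))
        · exact le_abs.2 (Or.inl (Set.mem_Ioi.1 hx).le)

lemma pi_gaussianReal_map_sum {ι : Type*} [Fintype ι] (v : NNReal) :
    (Measure.pi fun _ : ι => gaussianReal 0 v).map (fun x => ∑ i, x i) =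
      gaussianReal 0 (Fintype.card ι * v) := by
  refine Measure.ext_of_charFun (funext fun t => ?_)
  rw [charFun_map_sum_pi_eq_prod]
  simp only [Finset.prod_const, Finset.card_univ, Pi.pow_apply, charFun_gaussianReal,
    ← Complex.exp_nat_mul]
  congr 1
  push_cast
  ring

lemma pi_gaussianReal_map_inv_mul_sum {n : ℕ} (hn : n ≠ 0) (v : NNReal) :
    (Measure.pi fun _ : Fin n => gaussianReal 0 v).map (fun x => (n : ℝ)⁻¹ * ∑ i, x i) =
      gaussianReal 0 (v / n) := by
  have h := gaussianReal_map_const_mul (μ := 0) (v := Fintype.card (Fin n) * v) (n : ℝ)⁻¹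
  rw [← pi_gaussianReal_map_sum, Measure.map_map (by fun_prop) (by fun_prop)] at h
  refine h.trans ?_
  rw [mul_zero]
  congr 1
  ext
  simp
  field_simp


/-- (Gaussian mean-estimation lower bound.) Let `σ, ε > 0`, `0 < δ ≤ 1/2`, let
`x⁽¹⁾, …, x⁽ⁿ⁾` be i.i.d. `N(0, σ²)` (modelled via the product of `n` Gaussian measures), and
let `x̄` be their empirical mean. If `n < σ² (log √(e/(2π)) + log(1/δ)) / ε²`, then
`Pr[|x̄| ≥ ε] > δ`. -/
theorem gaussian_mean_estimation_lower_bound (σ ε δ : ℝ)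
    (hσ : 0 < σ) (hε : 0 < ε) (hδ : 0 < δ) (hδ2 : δ ≤ 1 / 2)
    (n : ℕ) (hn : 0 < n)
    (h : (n : ℝ) <
      σ ^ 2 * (Real.log (Real.sqrt (Real.exp 1 / (2 * π))) + Real.log (1 / δ)) / ε ^ 2) :
    ENNReal.ofReal δ <
      (Measure.pi fun _ : Fin n => gaussianReal 0 (σ ^ 2).toNNReal)
        {x | ε ≤ |(n : ℝ)⁻¹ * ∑ i, x i|} := by
  have hv : (σ ^ 2).toNNReal / (n : NNReal) ≠ 0 := by
    have : 0 < (σ ^ 2).toNNReal := Real.toNNReal_pos.2 (by positivity)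
    positivity
  have hmap := pi_gaussianReal_map_inv_mul_sum hn.ne' (σ ^ 2).toNNReal
  have hset : (Measure.pi fun _ : Fin n => gaussianReal 0 (σ ^ 2).toNNReal)
      {x | ε ≤ |(n : ℝ)⁻¹ * ∑ i, x i|} =
      gaussianReal 0 ((σ ^ 2).toNNReal / n) {y | ε ≤ |y|} := by
    rw [← hmap, Measure.map_apply (by fun_prop)
      (measurableSet_le measurable_const (by fun_prop))]
    rfl
  rw [hset]
  refine lt_of_lt_of_le ?_ (le_gaussianReal_le_abs hv hε.le)
  have hvar : -ε ^ 2 / (((σ ^ 2).toNNReal / (n : NNReal) : NNReal) : ℝ) =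
      -(n * ε ^ 2 / σ ^ 2) := by
    rw [NNReal.coe_div, Real.coe_toNNReal _ (by positivity), NNReal.coe_natCast]
    field_simp
  rw [hvar, ENNReal.ofReal_lt_ofReal_iff (by positivity), ← Real.log_lt_log_iff hδ (by positivity),
    Real.log_mul (by positivity) (by positivity), Real.log_exp]
  rw [one_div, Real.log_inv, lt_div_iff₀ (by positivity), mul_comm (σ ^ 2),
    ← div_lt_iff₀ (by positivity)] at h
  linarith
end
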